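/- Let ω(ξ) = -ξ|ξ|, ψ a Schwartz cutoff in time, W(t) the free group (W(t)φ)^(ξ) = e^{itω(ξ)}φ̂(ξ), and u a Schwartz function on ℝ². Then the Duhamel term satisfies F[ψ(t)·∫₀ᵗ W(t-s)(u(s)) ds](ξ,τ) = c ∫_ℝ F(u)(ξ,τ') · (ψ̂(τ-τ') - ψ̂(τ-ω(ξ)))/(τ'-ω(ξ)) dτ' for an absolute constant c. -/

import Mathlib

open MeasureTheory

noncomputable section

/-- Benjamin–Ono dispersion relation. -/
def ω (ξ : ℝ) : ℝ := -ξ * |ξ|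

/-- 1D Fourier transform (analyst's convention, kernel `e^{-ixξ}`). -/
def F1 (f : ℝ → ℂ) (ξ : ℝ) : ℂ :=
  ∫ x : ℝ, Complex.exp (-Complex.I * ((x * ξ : ℝ) : ℂ)) * f x

/-- 1D inverse Fourier transform. -/
def F1inv (f : ℝ → ℂ) (x : ℝ) : ℂ :=
  (((2 * Real.pi : ℝ)⁻¹ : ℝ) : ℂ) *
    ∫ ξ : ℝ, Complex.exp (Complex.I * ((x * ξ : ℝ) : ℂ)) * f ξ

/-- 2D (space-time) Fourier transform. -/
def F2 (f : ℝ × ℝ → ℂ) (q : ℝ × ℝ) : ℂ :=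
  ∫ p : ℝ × ℝ, Complex.exp (-Complex.I * ((p.1 * q.1 + p.2 * q.2 : ℝ) : ℂ)) * f p

/-- 2D inverse (space-time) Fourier transform. -/
def F2inv (f : ℝ × ℝ → ℂ) (p : ℝ × ℝ) : ℂ :=
  ((((2 * Real.pi) ^ 2 : ℝ)⁻¹ : ℝ) : ℂ) *
    ∫ q : ℝ × ℝ, Complex.exp (Complex.I * ((p.1 * q.1 + p.2 * q.2 : ℝ) : ℂ)) * f q

/-- Mixed norm `L^p_x L^q_t` of `u = u x t`. -/
def MixedNorm (p q : ENNReal) (u : ℝ → ℝ → ℂ) : ℝ :=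
  (eLpNorm (fun x => (eLpNorm (u x) q volume).toReal) p volume).toReal

/-- Dyadic frequency annulus `I_k`. -/
def Idy (k : ℤ) : Set ℝ := {ξ : ℝ | (2 : ℝ) ^ (k - 1) ≤ |ξ| ∧ |ξ| ≤ (2 : ℝ) ^ (k + 1)}

/-- The smooth dyadic bump `χ_l` built from `η₀`. -/
def chi (η₀ : ℝ → ℝ) (l : ℤ) (ξ : ℝ) : ℝ := η₀ (ξ / 2 ^ l) - η₀ (ξ / 2 ^ (l - 1))

/-- Free Benjamin–Ono evolution: `(W(t)φ)^(ξ) = e^{itω(ξ)} φ̂(ξ)`. -/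
def W (φ : ℝ → ℂ) (t x : ℝ) : ℂ :=
  F1inv (fun ξ => Complex.exp (Complex.I * ((t * ω ξ : ℝ) : ℂ)) * F1 φ ξ) x


lemma cont_cis {X : Type*} [TopologicalSpace X] {g : X → ℝ} (hg : Continuous g) :
    Continuous (fun x => Complex.exp (Complex.I * ((g x : ℝ) : ℂ))) := by
  fun_prop

lemma norm_cis (y : ℝ) : ‖Complex.exp (Complex.I * (y : ℂ))‖ = 1 :=
  Complex.norm_exp_I_mul_ofReal y

lemma integral_deriv_zero {k k' : ℝ → ℂ} (hk : Continuous k) (hd : ∀ x, x ≠ 0 → HasDerivAt k (k' x) x)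
    (hi : Integrable k) (hi' : Integrable k') : ∫ x, k' x = 0 := by
  have ht : Filter.Tendsto k Filter.atTop (nhds 0) :=
    tendsto_zero_of_hasDerivAt_of_integrableOn_Ioi (a := 0) (f' := k')
      (fun x hx => hd x (ne_of_gt hx)) hi'.integrableOn hi.integrableOn
  have hb : Filter.Tendsto k Filter.atBot (nhds 0) :=
    tendsto_zero_of_hasDerivAt_of_integrableOn_Iic (a := -1) (f' := k')
      (fun x hx => hd x (by rintro rfl; have h : (0 : ℝ) ≤ -1 := hx; linarith))
      hi'.integrableOn hi.integrableOn
  have h1 := integral_Ioi_of_hasDerivAt_of_tendsto (a := 0) (f := k) (f' := k')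
    hk.continuousWithinAt (fun x hx => hd x (ne_of_gt hx)) hi'.integrableOn ht
  have h2 := integral_Iic_of_hasDerivAt_of_tendsto (a := 0) (f := k) (f' := k')
    hk.continuousWithinAt (fun x hx => hd x (ne_of_lt hx)) hi'.integrableOn hb
  rw [← intervalIntegral.integral_Iic_add_Ioi (b := 0) hi'.integrableOn hi'.integrableOn, h1, h2]
  simp

lemma integrable_cis_mul {f : ℝ → ℂ} (hf : Integrable f) {g : ℝ → ℝ} (hg : Continuous g) :
    Integrable (fun η => Complex.exp (Complex.I * ((g η : ℝ) : ℂ)) * f η) :=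
  hf.bdd_mul (c := 1) (cont_cis hg).aestronglyMeasurable
    (Filter.Eventually.of_forall fun _ => (norm_cis _).le)

lemma ibp_cis {f f1 : ℝ → ℂ} (hf : Continuous f) (hd : ∀ x, x ≠ 0 → HasDerivAt f (f1 x) x)
    (hi : Integrable f) (hi1 : Integrable f1) (x : ℝ) :
    ∫ η, Complex.exp (Complex.I * ((x * η : ℝ) : ℂ)) * f1 η =
      -(Complex.I * x) * ∫ η, Complex.exp (Complex.I * ((x * η : ℝ) : ℂ)) * f η := by
  have hc : Continuous (fun η : ℝ => x * η) := by fun_prop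
  have a1 := integrable_cis_mul hi hc
  have a2 := integrable_cis_mul hi1 hc
  have := integral_deriv_zero (k := fun η => Complex.exp (Complex.I * ((x * η : ℝ) : ℂ)) * f η)
    (k' := fun η => (Complex.I * x) * (Complex.exp (Complex.I * ((x * η : ℝ) : ℂ)) * f η)
      + Complex.exp (Complex.I * ((x * η : ℝ) : ℂ)) * f1 η) ((cont_cis hc).mul hf) ?_ a1
      ((a1.const_mul _).add a2)
  · rw [integral_add (a1.const_mul _) a2, integral_const_mul] at this
    linear_combination this
  · intro η hη
    have e : HasDerivAt (fun η : ℝ => Complex.exp (Complex.I * ((x * η : ℝ) : ℂ)))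
        (Complex.exp (Complex.I * ((x * η : ℝ) : ℂ)) * (Complex.I * ((x * 1 : ℝ) : ℂ))) η :=
      ((((hasDerivAt_id η).const_mul x).ofReal_comp).const_mul Complex.I).cexp
    refine (e.mul (hd η hη)).congr_deriv ?_
    push_cast; ring

lemma ibp_bound {f f1 f2 : ℝ → ℂ} (hf : Continuous f) (hf1 : Continuous f1)
    (hd : ∀ x, x ≠ 0 → HasDerivAt f (f1 x) x) (hd1 : ∀ x, x ≠ 0 → HasDerivAt f1 (f2 x) x)
    (hi : Integrable f) (hi1 : Integrable f1) (hi2 : Integrable f2) (x : ℝ) :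
    (1 + x ^ 2) * ‖∫ η, Complex.exp (Complex.I * ((x * η : ℝ) : ℂ)) * f η‖ ≤
      (∫ η, ‖f η‖) + ∫ η, ‖f2 η‖ := by
  have h2 := ibp_cis hf1 hd1 hi1 hi2 x
  rw [ibp_cis hf hd hi hi1 x] at h2
  have b0 : ‖∫ η, Complex.exp (Complex.I * ((x * η : ℝ) : ℂ)) * f η‖ ≤ ∫ η, ‖f η‖ := by
    refine (norm_integral_le_integral_norm _).trans_eq ?_
    simp only [norm_mul, norm_cis, one_mul]
  have b2 : ‖∫ η, Complex.exp (Complex.I * ((x * η : ℝ) : ℂ)) * f2 η‖ ≤ ∫ η, ‖f2 η‖ := by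
    refine (norm_integral_le_integral_norm _).trans_eq ?_
    simp only [norm_mul, norm_cis, one_mul]
  rw [h2] at b2
  simp only [norm_mul, norm_neg, Complex.norm_I, Complex.norm_real, Real.norm_eq_abs, one_mul] at b2
  rw [← mul_assoc, abs_mul_abs_self] at b2
  nlinarith

lemma F1_eq (f : ℝ → ℂ) (ξ : ℝ) : F1 f ξ = FourierTransform.fourier f (ξ / (2 * Real.pi)) := by
  rw [Real.fourier_real_eq_integral_exp_smul, F1]
  congr 1; ext x
  rw [smul_eq_mul]
  congr 2
  have : (Real.pi : ℂ) ≠ 0 := by exact_mod_cast Real.pi_ne_zero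
  push_cast
  field_simp

lemma F1inv_eq (f : ℝ → ℂ) (x : ℝ) :
    F1inv f x = FourierTransformInv.fourierInv (fun y => f (2 * Real.pi * y)) x := by
  rw [Real.fourierInv_eq', F1inv]
  have := Measure.integral_comp_mul_left
    (fun ξ => Complex.exp (Complex.I * ((x * ξ : ℝ) : ℂ)) * f ξ) (2 * Real.pi)
  rw [abs_of_pos (by positivity)] at this
  rw [Complex.real_smul] at this
  rw [← this]
  congr 1; ext y
  rw [smul_eq_mul]
  congr 2
  simp
  ring

lemma F1inv_F1 {f : ℝ → ℂ} (hc : Continuous f) (hf : Integrable f) (hF : Integrable (F1 f)) (x : ℝ) :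
    F1inv (F1 f) x = f x := by
  have hp : (2 * Real.pi) ≠ 0 := by positivity
  rw [F1inv_eq]
  have : (fun y => F1 f (2 * Real.pi * y)) = FourierTransform.fourier f := by
    ext y; rw [F1_eq, mul_div_cancel_left₀ _ hp]
  rw [this, hc.fourierInv_fourier_eq hf]
  rw [← this]
  exact hF.comp_mul_left' hp

lemma F1_F1inv {f : ℝ → ℂ} (hc : Continuous f) (hf : Integrable f) (hF : Integrable (F1inv f)) (x : ℝ) :
    F1 (F1inv f) x = f x := by
  have hp : (2 * Real.pi) ≠ 0 := by positivity
  have : F1inv f = FourierTransformInv.fourierInv (fun y => f (2 * Real.pi * y)) := by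
    ext y; rw [F1inv_eq]
  rw [F1_eq, this, Continuous.fourier_fourierInv_eq (by fun_prop) (hf.comp_mul_left' hp)]
  · field_simp
  · have h := hF.comp_neg
    rw [this] at h
    refine h.congr (Filter.Eventually.of_forall fun y => ?_)
    simp [Real.fourierInv_eq_fourier_neg]

lemma F2_schwartz (u : SchwartzMap (ℝ × ℝ) ℂ) : ∃ U : SchwartzMap (ℝ × ℝ) ℂ, ∀ q, U q = F2 u q := by
  let L := WithLp.prodContinuousLinearEquiv 2 ℝ ℝ ℝ
  let S : (ℝ × ℝ) ≃L[ℝ] (ℝ × ℝ) :=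
    (LinearEquiv.smulOfNeZero ℝ (ℝ × ℝ) ((2 * Real.pi)⁻¹) (by positivity)).toContinuousLinearEquiv
  let u' := SchwartzMap.compCLMOfContinuousLinearEquiv ℂ L u
  refine ⟨SchwartzMap.compCLMOfContinuousLinearEquiv ℂ (S.trans L.symm)
    (FourierTransform.fourier u'), fun q => ?_⟩
  rw [SchwartzMap.compCLMOfContinuousLinearEquiv_apply, SchwartzMap.fourier_coe,
    Function.comp_apply, Real.fourier_eq', F2]
  have hm := (WithLp.volume_preserving_symm_measurableEquiv_toLp_prod ℝ ℝ)
  rw [← hm.integral_comp']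
  congr 1; ext v
  rw [smul_eq_mul]
  have hp : (Real.pi : ℂ) ≠ 0 := by exact_mod_cast Real.pi_ne_zero
  have hS : (S.trans L.symm) q = WithLp.toLp 2 ((2 * Real.pi)⁻¹ • q) := rfl
  have hu : u' v = u ((MeasurableEquiv.toLp 2 (ℝ × ℝ)).symm v) := rfl
  rw [hu]
  congr 2
  rw [hS, WithLp.prod_inner_apply]
  simp
  field_simp

lemma decay (V : SchwartzMap (ℝ × ℝ) ℂ) : ∃ C : ℝ, 0 ≤ C ∧ ∀ η τ : ℝ,
    (1 + η ^ 2) ^ 2 * ‖V (η, τ)‖ ≤ C * (1 + τ ^ 2)⁻¹ := by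
  refine ⟨2 ^ 6 * ((Finset.Iic (6, 0)).sup fun m => SchwartzMap.seminorm ℝ m.1 m.2) V, 
    by positivity, fun η τ => ?_⟩
  have h := SchwartzMap.one_add_le_sup_seminorm_apply (𝕜 := ℝ) (m := (6, 0)) (k := 6) (n := 0)
    le_rfl le_rfl V (η, τ)
  rw [norm_iteratedFDeriv_zero] at h
  rw [← div_eq_mul_inv, le_div_iff₀ (by positivity)]
  refine le_trans ?_ h
  have h1 : |η| ≤ ‖(η, τ)‖ := norm_fst_le (η, τ)
  have h2 : |τ| ≤ ‖(η, τ)‖ := norm_snd_le (η, τ)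
  have aux : ∀ a : ℝ, |a| ≤ ‖(η, τ)‖ → 1 + a ^ 2 ≤ (1 + ‖(η, τ)‖) ^ 2 := by
    intro a ha
    have := abs_nonneg a
    rw [← sq_abs]; nlinarith
  have k1 := aux η h1
  have k2 := aux τ h2
  calc (1 + η ^ 2) ^ 2 * ‖V (η, τ)‖ * (1 + τ ^ 2) = (1 + η ^ 2) ^ 2 * (1 + τ ^ 2) * ‖V (η, τ)‖ := by ring
    _ ≤ ((1 + ‖(η, τ)‖) ^ 2) ^ 2 * (1 + ‖(η, τ)‖) ^ 2 * ‖V (η, τ)‖ := by gcongr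
    _ = _ := by ring

lemma continuous_ω : Continuous ω := by unfold ω; fun_prop

lemma hasDerivAt_ω {η : ℝ} (h : η ≠ 0) : HasDerivAt ω (-2 * |η|) η := by
  unfold ω
  refine ((hasDerivAt_neg η).mul (hasDerivAt_abs h)).congr_deriv ?_
  rcases lt_or_gt_of_ne h with h | h
  · simp [abs_of_neg h, h]; ring
  · simp [abs_of_pos h, h]; ring

lemma hasDerivAt_slice (V : SchwartzMap (ℝ × ℝ) ℂ) (η τ : ℝ) :
    HasDerivAt (fun η => V (η, τ)) (LineDeriv.lineDerivOp ((1 : ℝ), (0 : ℝ)) V (η, τ)) η := by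
  rw [SchwartzMap.lineDerivOp_apply_eq_fderiv]
  exact V.differentiableAt.hasFDerivAt.comp_hasDerivAt η
    ((hasDerivAt_id η).prodMk (hasDerivAt_const η τ))

/-- Space profile of a single time frequency. -/
def Jf (U : ℝ × ℝ → ℂ) (r x τ : ℝ) : ℂ :=
  ∫ η, Complex.exp (Complex.I * ((x * η : ℝ) : ℂ)) *
    (Complex.exp (Complex.I * ((r * ω η : ℝ) : ℂ)) * U (η, τ))

lemma slice_integrable (V : SchwartzMap (ℝ × ℝ) ℂ) (τ : ℝ) : Integrable (fun η => V (η, τ)) := by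
  obtain ⟨C, hC, h⟩ := decay V
  refine (integrable_inv_one_add_sq.const_mul (C * (1 + τ ^ 2)⁻¹)).mono'
    (by have := V.continuous; fun_prop) (Filter.Eventually.of_forall fun η => ?_)
  rw [← div_eq_mul_inv, le_div_iff₀ (by positivity), mul_comm]
  refine le_trans ?_ (h η τ)
  gcongr
  nlinarith [sq_nonneg η]

lemma slice_integrable' (V : SchwartzMap (ℝ × ℝ) ℂ) (η : ℝ) : Integrable (fun τ => V (η, τ)) := by
  obtain ⟨C, hC, h⟩ := decay V
  refine (integrable_inv_one_add_sq.const_mul C).mono'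
    (by have := V.continuous; fun_prop) (Filter.Eventually.of_forall fun τ => ?_)
  refine le_trans ?_ (h η τ)
  have : 1 ≤ (1 + η ^ 2) ^ 2 := by nlinarith [sq_nonneg η, sq_nonneg (η ^ 2)]
  nlinarith [norm_nonneg (V (η, τ))]

lemma Jf_bound (U : SchwartzMap (ℝ × ℝ) ℂ) : ∃ C : ℝ, 0 ≤ C ∧ ∀ r x τ : ℝ,
    ‖Jf U r x τ‖ ≤ C * (1 + |r|) ^ 2 * (1 + x ^ 2)⁻¹ * (1 + τ ^ 2)⁻¹ := by
  set U1 := LineDeriv.lineDerivOp ((1 : ℝ), (0 : ℝ)) U with hU1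
  set U2 := LineDeriv.lineDerivOp ((1 : ℝ), (0 : ℝ)) U1 with hU2
  obtain ⟨C0, hC0, h0⟩ := decay U
  obtain ⟨C1, hC1, h1⟩ := decay U1
  obtain ⟨C2, hC2, h2⟩ := decay U2
  set M := ∫ η : ℝ, (1 + η ^ 2)⁻¹ with hM
  have hMn : 0 ≤ M := integral_nonneg fun η => by positivity
  refine ⟨12 * (C0 + C1 + C2) * M, by positivity, fun r x τ => ?_⟩
  -- pointwise bounds
  have key : ∀ (V : SchwartzMap (ℝ × ℝ) ℂ) (C : ℝ),
      (∀ η τ : ℝ, (1 + η ^ 2) ^ 2 * ‖V (η, τ)‖ ≤ C * (1 + τ ^ 2)⁻¹) →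
      ∀ η, (1 + η ^ 2) * ‖V (η, τ)‖ ≤ C * (1 + τ ^ 2)⁻¹ * (1 + η ^ 2)⁻¹ := by
    intro V C h η
    rw [← div_eq_mul_inv, le_div_iff₀ (by positivity)]
    refine le_trans (le_of_eq ?_) (h η τ)
    ring
  have k0 := key U C0 h0
  have k1 := key U1 C1 h1
  have k2 := key U2 C2 h2
  set T := (1 + τ ^ 2)⁻¹ with hT
  have hTp : 0 < T := by positivity
  set K := 4 * (1 + |r|) ^ 2 * ((C0 + C1 + C2) * T) with hK
  have hKI : Integrable (fun η : ℝ => K * (1 + η ^ 2)⁻¹) := integrable_inv_one_add_sq.const_mul K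
  have gen : ∀ (a b c : ℝ) (η : ℝ), 0 ≤ a → 0 ≤ b → 0 ≤ c →
      a ≤ 4 * (1 + |r|) ^ 2 * (1 + η ^ 2) → b ≤ 4 * (1 + |r|) ^ 2 * (1 + η ^ 2) →
      c ≤ 4 * (1 + |r|) ^ 2 * (1 + η ^ 2) →
      a * ‖U (η, τ)‖ + b * ‖U1 (η, τ)‖ + c * ‖U2 (η, τ)‖ ≤ K * (1 + η ^ 2)⁻¹ := by
    intro a b c η ha hb hc ha' hb' hc'
    calc _ ≤ (4 * (1 + |r|) ^ 2 * (1 + η ^ 2)) * ‖U (η, τ)‖ +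
          (4 * (1 + |r|) ^ 2 * (1 + η ^ 2)) * ‖U1 (η, τ)‖ +
          (4 * (1 + |r|) ^ 2 * (1 + η ^ 2)) * ‖U2 (η, τ)‖ := by gcongr
      _ = 4 * (1 + |r|) ^ 2 * ((1 + η ^ 2) * ‖U (η, τ)‖ + (1 + η ^ 2) * ‖U1 (η, τ)‖ +
          (1 + η ^ 2) * ‖U2 (η, τ)‖) := by ring
      _ ≤ 4 * (1 + |r|) ^ 2 * (C0 * T * (1 + η ^ 2)⁻¹ + C1 * T * (1 + η ^ 2)⁻¹ +
          C2 * T * (1 + η ^ 2)⁻¹) := by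
          refine mul_le_mul_of_nonneg_left (add_le_add (add_le_add (k0 η) (k1 η)) (k2 η)) ?_
          positivity
      _ = _ := by rw [hK]; ring
  set E : ℝ → ℂ := fun η => Complex.exp (Complex.I * ((r * ω η : ℝ) : ℂ)) with hE
  have hEc : Continuous E := cont_cis (by have := continuous_ω; fun_prop)
  have hEn : ∀ η, ‖E η‖ = 1 := fun η => norm_cis _
  have hEd : ∀ η, η ≠ 0 → HasDerivAt E (E η * (-2 * Complex.I * r * |η|)) η := by
    intro η hη
    refine (((((hasDerivAt_ω hη).const_mul r).ofReal_comp).const_mul Complex.I).cexp).congr_deriv ?_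
    simp only [hE]; push_cast; ring
  have hUc := U.continuous
  have hU1c := U1.continuous
  have hU2c := U2.continuous
  have hr := abs_nonneg r
  have hq : ∀ η : ℝ, |η| ≤ 1 + η ^ 2 := fun η => by
    rw [← sq_abs]; nlinarith [sq_nonneg (|η| - 1), abs_nonneg η]
  have e1 : 1 ≤ (1 + |r|) ^ 2 := by nlinarith
  have e2 : |r| ≤ (1 + |r|) ^ 2 := by nlinarith
  have e3 : |r| ^ 2 ≤ (1 + |r|) ^ 2 := by nlinarith
  set f : ℝ → ℂ := fun η => E η * U (η, τ) with hf
  set f1 : ℝ → ℂ := fun η => E η * (U1 (η, τ) + -2 * Complex.I * r * |η| * U (η, τ)) with hf1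
  set f2 : ℝ → ℂ := fun η => E η * ((-2 * Complex.I * r * (SignType.sign η : ℝ) +
      (-2 * Complex.I * r * |η|) ^ 2) * U (η, τ) +
      2 * (-2 * Complex.I * r * |η|) * U1 (η, τ) + U2 (η, τ)) with hf2
  have hfc : Continuous f := by fun_prop
  have hf1c : Continuous f1 := by
    have : Continuous (fun η : ℝ => ((|η| : ℝ) : ℂ)) := by fun_prop
    fun_prop
  have bf : ∀ η, ‖f η‖ ≤ K * (1 + η ^ 2)⁻¹ := by
    intro η
    have := gen 1 0 0 η zero_le_one le_rfl le_rfl (by nlinarith [sq_nonneg η]) (by positivity) (by positivity)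
    simpa [hf, hEn] using this
  have bf1 : ∀ η, ‖f1 η‖ ≤ K * (1 + η ^ 2)⁻¹ := by
    intro η
    refine le_trans ?_ (gen (2 * |r| * |η|) 1 0 η (by positivity) zero_le_one le_rfl ?_
      (by nlinarith [sq_nonneg η]) (by positivity))
    · simp only [hf1, norm_mul, hEn, one_mul]
      refine (norm_add_le _ _).trans (le_of_eq ?_)
      simp; ring
    · calc 2 * |r| * |η| ≤ 2 * (1 + |r|) ^ 2 * (1 + η ^ 2) := by gcongr; exact hq η
        _ ≤ _ := by gcongr; norm_num
  have bf2 : ∀ η, ‖f2 η‖ ≤ 2 * (K * (1 + η ^ 2)⁻¹) := by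
    intro η
    have hs : |(SignType.sign η : ℝ)| ≤ 1 := by
      rcases lt_trichotomy η 0 with h | h | h <;> simp [h]
    have hs2 : |η| ^ 2 ≤ 1 + η ^ 2 := by rw [sq_abs]; linarith
    have g1 := gen (2 * |r|) (2 * (2 * |r| * |η|)) 1 η (by positivity) (by positivity) zero_le_one
      (by nlinarith [sq_nonneg η])
      (by calc 2 * (2 * |r| * |η|) = 4 * |r| * |η| := by ring
          _ ≤ 4 * (1 + |r|) ^ 2 * (1 + η ^ 2) := by gcongr; exact hq η)
      (by nlinarith [sq_nonneg η])
    have g2 := gen (4 * |r| ^ 2 * |η| ^ 2) 0 0 η (by positivity) le_rfl le_rfl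
      (by gcongr) (by positivity) (by positivity)
    have : ‖f2 η‖ ≤ (2 * |r| * 1 + (2 * |r| * |η|) ^ 2) * ‖U (η, τ)‖ +
        2 * (2 * |r| * |η|) * ‖U1 (η, τ)‖ + ‖U2 (η, τ)‖ := by
      simp only [hf2, norm_mul, hEn, one_mul]
      refine (norm_add_le _ _).trans ?_
      gcongr
      refine (norm_add_le _ _).trans ?_
      rw [norm_mul]
      gcongr
      · refine (norm_add_le _ _).trans ?_
        simp only [norm_mul, norm_pow, norm_neg, Complex.norm_I, Complex.norm_real,
          Real.norm_eq_abs, Complex.norm_ofNat, abs_abs, mul_one]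
        have := mul_le_mul_of_nonneg_left hs (by positivity : 0 ≤ 2 * |r|)
        linarith
      · simp
    linarith
  have If : Integrable f := hKI.mono' hfc.aestronglyMeasurable (Filter.Eventually.of_forall bf)
  have If1 : Integrable f1 := hKI.mono' hf1c.aestronglyMeasurable (Filter.Eventually.of_forall bf1)
  have hf2m : AEStronglyMeasurable f2 := by
    have m1 : Measurable (fun η : ℝ => (SignType.sign η : ℝ)) := by
      have : (fun η : ℝ => (SignType.sign η : ℝ)) = fun η => if η < 0 then -1 else if η = 0 then 0 else 1 := by
        ext η
        rcases lt_trichotomy η 0 with h | h | h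
        · simp [h]
        · simp [h]
        · simp [h, h.not_gt, h.ne']
      rw [this]
      exact Measurable.ite measurableSet_Iio measurable_const
        (Measurable.ite (measurableSet_singleton 0) measurable_const measurable_const)
    have m2 := hEc.measurable
    have m3 : Measurable (fun η => U (η, τ)) := by fun_prop
    have m4 : Measurable (fun η => U1 (η, τ)) := by fun_prop
    have m5 : Measurable (fun η => U2 (η, τ)) := by fun_prop
    have m6 : Measurable (fun η : ℝ => ((|η| : ℝ) : ℂ)) := by fun_prop
    have m7 : Measurable (fun η : ℝ => ((SignType.sign η : ℝ) : ℂ)) := Complex.measurable_ofReal.comp m1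
    apply Measurable.aestronglyMeasurable
    fun_prop
  have If2 : Integrable f2 := (hKI.const_mul 2).mono' hf2m (Filter.Eventually.of_forall bf2)
  have d1 : ∀ η, η ≠ 0 → HasDerivAt f (f1 η) η := by
    intro η hη
    refine ((hEd η hη).mul (hasDerivAt_slice U η τ)).congr_deriv ?_
    simp only [hf1, ← hU1]; ring
  have d2 : ∀ η, η ≠ 0 → HasDerivAt f1 (f2 η) η := by
    intro η hη
    have a := (((hasDerivAt_abs hη).ofReal_comp).const_mul (-2 * Complex.I * r)).mul
      (hasDerivAt_slice U η τ)
    refine ((hEd η hη).mul ((hasDerivAt_slice U1 η τ).add a)).congr_deriv ?_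
    simp only [hf2, ← hU1, ← hU2, Pi.add_apply, Pi.mul_apply]; ring
  have fin := ibp_bound hfc hf1c d1 d2 If If1 If2 x
  have i0 : ∫ η, ‖f η‖ ≤ K * M := by
    rw [hM, ← integral_const_mul]; exact integral_mono If.norm hKI bf
  have i2 : ∫ η, ‖f2 η‖ ≤ 2 * (K * M) := by
    rw [hM, ← integral_const_mul, ← integral_const_mul]; exact integral_mono If2.norm (hKI.const_mul 2) bf2
  have hJ : Jf U r x τ = ∫ η, Complex.exp (Complex.I * ((x * η : ℝ) : ℂ)) * f η := rfl
  rw [← hJ] at fin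
  have : ‖Jf U r x τ‖ * (1 + x ^ 2) ≤ 12 * (C0 + C1 + C2) * M * (1 + |r|) ^ 2 * T := by
    have e : 12 * (C0 + C1 + C2) * M * (1 + |r|) ^ 2 * T = 3 * (K * M) := by rw [hK]; ring
    rw [e]; linarith
  rw [← le_div_iff₀ (by positivity)] at this
  refine this.trans (le_of_eq ?_)
  rw [div_eq_mul_inv]; ring

lemma F1_slice_cont (u : SchwartzMap (ℝ × ℝ) ℂ) (η : ℝ) :
    Continuous (fun s => F1 (fun y => u (y, s)) η) := by
  obtain ⟨C, hC, h⟩ := decay u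
  have hu := u.continuous
  unfold F1
  refine continuous_of_dominated (bound := fun y => C * (1 + y ^ 2)⁻¹) ?_ ?_
    (integrable_inv_one_add_sq.const_mul C) ?_
  · intro s
    exact Continuous.aestronglyMeasurable (by fun_prop)
  · intro s
    refine Filter.Eventually.of_forall fun y => ?_
    have e : -Complex.I * ((y * η : ℝ) : ℂ) = Complex.I * ((-(y * η) : ℝ) : ℂ) := by push_cast; ring
    rw [e, norm_mul, norm_cis, one_mul, ← div_eq_mul_inv, le_div_iff₀ (by positivity)]
    have h1 := h y s
    have h2 : C * (1 + s ^ 2)⁻¹ ≤ C := by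
      apply mul_le_of_le_one_right hC
      apply inv_le_one_of_one_le₀; nlinarith [sq_nonneg s]
    have h3 : (1 + y ^ 2) * ‖u (y, s)‖ ≤ (1 + y ^ 2) ^ 2 * ‖u (y, s)‖ := by
      gcongr; nlinarith [sq_nonneg y]
    linarith
  · refine Filter.Eventually.of_forall fun y => ?_
    fun_prop

lemma neg_cis (y : ℝ) : -Complex.I * (y : ℂ) = Complex.I * ((-y : ℝ) : ℂ) := by push_cast; ring

lemma F2_fubini (u : SchwartzMap (ℝ × ℝ) ℂ) (η τ : ℝ) :
    F1 (fun s => F1 (fun y => u (y, s)) η) τ = F2 u (η, τ) := by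
  have hu := u.continuous
  have hI : Integrable (fun p : ℝ × ℝ =>
      Complex.exp (-Complex.I * ((p.1 * η + p.2 * τ : ℝ) : ℂ)) * u p) := by
    refine (u.integrable (μ := volume)).bdd_mul (c := 1)
      (Continuous.aestronglyMeasurable (by fun_prop)) (Filter.Eventually.of_forall fun p => ?_)
    rw [neg_cis, norm_cis]
  rw [F2, Measure.volume_eq_prod, integral_prod_symm _ hI, F1]
  congr 1; ext s
  rw [F1, ← integral_const_mul]
  congr 1; ext y
  rw [← mul_assoc, ← Complex.exp_add]
  congr 2
  push_cast; ring

lemma F1_slice_integrable (u : SchwartzMap (ℝ × ℝ) ℂ) (η : ℝ) :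
    Integrable (fun s => F1 (fun y => u (y, s)) η) := by
  have hi : Integrable (fun s => ∫ y, ‖u (y, s)‖) :=
    Integrable.integral_norm_prod_right (u.integrable (μ := (volume : Measure ℝ).prod volume))
  refine hi.mono' (F1_slice_cont u η).aestronglyMeasurable (Filter.Eventually.of_forall fun s => ?_)
  refine (norm_integral_le_integral_norm _).trans_eq ?_
  simp only [norm_mul, neg_cis, norm_cis, one_mul]

lemma slice_inv (u U : SchwartzMap (ℝ × ℝ) ℂ) (hU : ∀ q, U q = F2 u q) (η s : ℝ) :
    F1 (fun y => u (y, s)) η = (((2 * Real.pi : ℝ)⁻¹ : ℝ) : ℂ) *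
      ∫ τ : ℝ, Complex.exp (Complex.I * ((s * τ : ℝ) : ℂ)) * U (η, τ) := by
  have e : F1 (fun s => F1 (fun y => u (y, s)) η) = fun τ => U (η, τ) := by
    ext τ; rw [F2_fubini, hU]
  rw [← F1inv_F1 (F1_slice_cont u η) (F1_slice_integrable u η) (by rw [e]; exact slice_integrable' U η) s,
    e, F1inv]

lemma W_eq (u U : SchwartzMap (ℝ × ℝ) ℂ) (hU : ∀ q, U q = F2 u q) (s r x : ℝ) :
    W (fun y => u (y, s)) r x = ((((2 * Real.pi : ℝ)⁻¹ : ℝ) : ℂ)) ^ 2 *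
      ∫ τ : ℝ, Complex.exp (Complex.I * ((s * τ : ℝ) : ℂ)) * Jf U r x τ := by
  have hUc := U.continuous
  have hω := continuous_ω
  have hI : Integrable (fun p : ℝ × ℝ => Complex.exp (Complex.I * ((x * p.1 : ℝ) : ℂ)) *
      (Complex.exp (Complex.I * ((r * ω p.1 : ℝ) : ℂ)) *
        (Complex.exp (Complex.I * ((s * p.2 : ℝ) : ℂ)) * U p))) ((volume : Measure ℝ).prod volume) := by
    refine (U.integrable (μ := (volume : Measure ℝ).prod volume)).mono 
      (Continuous.aestronglyMeasurable (by fun_prop)) (Filter.Eventually.of_forall fun p => ?_)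
    simp only [norm_mul, norm_cis, one_mul, le_refl]
  have hs := integral_integral_swap (f := fun η τ => Complex.exp (Complex.I * ((x * η : ℝ) : ℂ)) *
      (Complex.exp (Complex.I * ((r * ω η : ℝ) : ℂ)) *
        (Complex.exp (Complex.I * ((s * τ : ℝ) : ℂ)) * U (η, τ)))) hI
  have h1 : ∀ τ, Complex.exp (Complex.I * ((s * τ : ℝ) : ℂ)) * Jf U r x τ =
      ∫ η, Complex.exp (Complex.I * ((x * η : ℝ) : ℂ)) *
      (Complex.exp (Complex.I * ((r * ω η : ℝ) : ℂ)) *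
        (Complex.exp (Complex.I * ((s * τ : ℝ) : ℂ)) * U (η, τ))) := by
    intro τ
    rw [Jf, ← integral_const_mul]
    congr 1; ext η; ring
  simp_rw [h1]
  rw [← hs, W, F1inv, pow_two, mul_assoc]
  congr 1
  rw [← integral_const_mul]
  congr 1; ext η
  rw [slice_inv u U hU, integral_const_mul, integral_const_mul]
  ring

lemma Jf_fourier (U : SchwartzMap (ℝ × ℝ) ℂ) (r τ ξ : ℝ) :
    ∫ x, Complex.exp (-Complex.I * ((x * ξ : ℝ) : ℂ)) * Jf U r x τ =
      2 * Real.pi * (Complex.exp (Complex.I * ((r * ω ξ : ℝ) : ℂ)) * U (ξ, τ)) := by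
  have hUc := U.continuous
  have hω := continuous_ω
  set f : ℝ → ℂ := fun η => Complex.exp (Complex.I * ((r * ω η : ℝ) : ℂ)) * U (η, τ) with hf
  have hfc : Continuous f := by fun_prop
  have hfi : Integrable f := integrable_cis_mul (slice_integrable U τ) (by fun_prop)
  have e : F1inv f = fun x => (((2 * Real.pi : ℝ)⁻¹ : ℝ) : ℂ) * Jf U r x τ := rfl
  obtain ⟨C, hC, hb⟩ := Jf_bound U
  have hJc : Continuous (fun x => Jf U r x τ) := by
    refine continuous_of_dominated (bound := fun η => ‖f η‖) ?_ ?_ hfi.norm ?_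
    · intro x; exact Continuous.aestronglyMeasurable (by fun_prop)
    · intro x; refine Filter.Eventually.of_forall fun η => ?_
      rw [norm_mul, norm_cis, one_mul]
    · refine Filter.Eventually.of_forall fun η => ?_
      fun_prop
  have hJ : Integrable (fun x => Jf U r x τ) := by
    refine (integrable_inv_one_add_sq.const_mul (C * (1 + |r|) ^ 2 * (1 + τ ^ 2)⁻¹)).mono'
      hJc.aestronglyMeasurable (Filter.Eventually.of_forall fun x => ?_)
    refine (hb r x τ).trans (le_of_eq (by ring))
  have h := F1_F1inv hfc hfi (by rw [e]; exact hJ.const_mul _) ξ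
  rw [e, F1] at h
  simp_rw [mul_left_comm _ (((2 * Real.pi : ℝ)⁻¹ : ℝ) : ℂ)] at h
  rw [integral_const_mul] at h
  have hp : (Real.pi : ℂ) ≠ 0 := by exact_mod_cast Real.pi_ne_zero
  change _ = 2 * (Real.pi : ℂ) * f ξ
  have hp2 : 2 * (Real.pi : ℂ) ≠ 0 := mul_ne_zero two_ne_zero hp
  rw [← h, Complex.ofReal_inv, Complex.ofReal_mul, Complex.ofReal_ofNat, ← mul_assoc,
    mul_inv_cancel₀ hp2, one_mul]

lemma Jf_cont (U : SchwartzMap (ℝ × ℝ) ℂ) :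
    Continuous (fun p : ℝ × ℝ × ℝ => Jf U p.1 p.2.1 p.2.2) := by
  obtain ⟨C, hC, h⟩ := decay U
  have hUc := U.continuous
  have hω := continuous_ω
  refine continuous_of_dominated (bound := fun y => C * (1 + y ^ 2)⁻¹) ?_ ?_
    (integrable_inv_one_add_sq.const_mul C) ?_
  · intro p
    exact Continuous.aestronglyMeasurable (by fun_prop)
  · intro p
    refine Filter.Eventually.of_forall fun y => ?_
    rw [norm_mul, norm_mul, norm_cis, norm_cis, one_mul, one_mul, ← div_eq_mul_inv,
      le_div_iff₀ (by positivity)]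
    have h1 := h y p.2.2
    have h2 : C * (1 + p.2.2 ^ 2)⁻¹ ≤ C := by
      apply mul_le_of_le_one_right hC
      apply inv_le_one_of_one_le₀; nlinarith [sq_nonneg p.2.2]
    have h3 : (1 + y ^ 2) * ‖U (y, p.2.2)‖ ≤ (1 + y ^ 2) ^ 2 * ‖U (y, p.2.2)‖ := by
      gcongr; nlinarith [sq_nonneg y]
    linarith
  · refine Filter.Eventually.of_forall fun y => ?_
    fun_prop

/-- The elementary time integral. -/
lemma theta_integral (t τ w : ℝ) (h : τ ≠ w) :
    ∫ θ in Set.Ioc (0 : ℝ) 1, (t : ℂ) * (Complex.exp (Complex.I * ((t * θ * τ : ℝ) : ℂ)) *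
      Complex.exp (Complex.I * (((t - t * θ) * w : ℝ) : ℂ))) =
    (Complex.exp (Complex.I * ((t * τ : ℝ) : ℂ)) - Complex.exp (Complex.I * ((t * w : ℝ) : ℂ))) /
      (Complex.I * ((τ - w : ℝ) : ℂ)) := by
  have hne : (Complex.I * ((τ - w : ℝ) : ℂ)) ≠ 0 := by
    have : τ - w ≠ 0 := sub_ne_zero.2 h
    simp only [ne_eq, mul_eq_zero, Complex.I_ne_zero, false_or]
    exact_mod_cast this
  rw [← intervalIntegral.integral_of_le zero_le_one]
  have hd : ∀ θ : ℝ, HasDerivAt (fun θ : ℝ =>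
      Complex.exp (Complex.I * ((t * w + θ * (t * (τ - w)) : ℝ) : ℂ)) / (Complex.I * ((τ - w : ℝ) : ℂ)))
      ((t : ℂ) * (Complex.exp (Complex.I * ((t * θ * τ : ℝ) : ℂ)) *
      Complex.exp (Complex.I * (((t - t * θ) * w : ℝ) : ℂ)))) θ := by
    intro θ
    have a : HasDerivAt (fun θ : ℝ => t * w + θ * (t * (τ - w))) (1 * (t * (τ - w))) θ :=
      ((hasDerivAt_id θ).mul_const _).const_add _
    refine ((a.ofReal_comp.const_mul Complex.I).cexp.div_const _).congr_deriv ?_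
    rw [← Complex.exp_add, div_eq_iff hne]
    have : Complex.I * ((t * θ * τ : ℝ) : ℂ) + Complex.I * (((t - t * θ) * w : ℝ) : ℂ) =
      Complex.I * ((t * w + θ * (t * (τ - w)) : ℝ) : ℂ) := by push_cast; ring
    rw [this]; push_cast; ring
  rw [intervalIntegral.integral_eq_sub_of_hasDerivAt (fun θ _ => hd θ)
    (Continuous.intervalIntegrable (by fun_prop) _ _)]
  rw [← sub_div]
  congr 4
  · push_cast; ring
  · simp

/-- The full phase-space integrand; `z = ((x, t), (θ, τ))`. -/
def Phi (ψ : ℝ → ℂ) (U : ℝ × ℝ → ℂ) (ξ τ₀ : ℝ) (z : (ℝ × ℝ) × (ℝ × ℝ)) : ℂ :=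
  Complex.exp (-Complex.I * ((z.1.1 * ξ + z.1.2 * τ₀ : ℝ) : ℂ)) * (ψ z.1.2 * ((z.1.2 : ℂ) *
    (Complex.exp (Complex.I * ((z.1.2 * z.2.1 * z.2.2 : ℝ) : ℂ)) *
      Jf U (z.1.2 - z.1.2 * z.2.1) z.1.1 z.2.2)))

/-- The measure on `(θ, τ)`. -/
def nuq : Measure (ℝ × ℝ) := (volume.restrict (Set.Ioc (0 : ℝ) 1)).prod volume

instance : SFinite nuq := by unfold nuq; infer_instance

lemma psi_weight (ψ : SchwartzMap ℝ ℂ) :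
    Integrable (fun t => ‖ψ t‖ * (|t| * (1 + |t|) ^ 2)) := by
  have h1 := ψ.integrable_pow_mul volume 1
  have h2 := ψ.integrable_pow_mul volume 2
  have h3 := ψ.integrable_pow_mul volume 3
  refine ((h1.add (h2.const_mul 2)).add h3).congr (Filter.Eventually.of_forall fun t => ?_)
  simp only [Pi.add_apply, Real.norm_eq_abs]
  ring

lemma Phi_integrable (ψ : SchwartzMap ℝ ℂ) (U : SchwartzMap (ℝ × ℝ) ℂ) (ξ τ₀ : ℝ) :
    Integrable (Phi ψ U ξ τ₀) (((volume : Measure ℝ).prod volume).prod nuq) := by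
  obtain ⟨C, hC, hb⟩ := Jf_bound U
  have hψ := ψ.continuous
  have hJ := Jf_cont U
  have hcont : Continuous (Phi ψ U ξ τ₀) := by
    have : Continuous (fun z : (ℝ × ℝ) × (ℝ × ℝ) => Jf U (z.1.2 - z.1.2 * z.2.1) z.1.1 z.2.2) :=
      hJ.comp (g := fun p : ℝ × ℝ × ℝ => Jf U p.1 p.2.1 p.2.2)
        (f := fun z : (ℝ × ℝ) × (ℝ × ℝ) => (z.1.2 - z.1.2 * z.2.1, z.1.1, z.2.2)) (by fun_prop)
    unfold Phi
    fun_prop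
  have i1 : Integrable (fun p : ℝ × ℝ => (1 + p.1 ^ 2)⁻¹ * (‖ψ p.2‖ * (|p.2| * (1 + |p.2|) ^ 2)))
      ((volume : Measure ℝ).prod volume) :=
    integrable_inv_one_add_sq.mul_prod (psi_weight ψ)
  have i2 : Integrable (fun q : ℝ × ℝ => (1 : ℝ) * (1 + q.2 ^ 2)⁻¹) nuq :=
    Integrable.mul_prod (f := fun _ => (1 : ℝ)) (integrable_const 1) integrable_inv_one_add_sq
  have i3 := (i1.mul_prod i2).const_mul C
  refine i3.mono' hcont.aestronglyMeasurable ?_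
  have hae : ∀ᵐ z ∂(((volume : Measure ℝ).prod (volume : Measure ℝ)).prod nuq),
      z.2.1 ∈ Set.Ioc (0 : ℝ) 1 := by
    have a1 : ∀ᵐ q ∂nuq, q.1 ∈ Set.Ioc (0 : ℝ) 1 :=
      Measure.quasiMeasurePreserving_fst.ae (ae_restrict_mem measurableSet_Ioc)
    exact Measure.quasiMeasurePreserving_snd.ae a1
  filter_upwards [hae] with z hz
  unfold Phi
  rw [neg_cis]
  simp only [norm_mul, norm_cis, one_mul, Complex.norm_real, Real.norm_eq_abs]
  have h1 := hb (z.1.2 - z.1.2 * z.2.1) z.1.1 z.2.2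
  have h2 : |z.1.2 - z.1.2 * z.2.1| ≤ |z.1.2| := by
    have : z.1.2 - z.1.2 * z.2.1 = z.1.2 * (1 - z.2.1) := by ring
    rw [this, abs_mul]
    apply mul_le_of_le_one_right (abs_nonneg _)
    rw [abs_le]; constructor <;> linarith [hz.1, hz.2]
  calc ‖ψ z.1.2‖ * (|z.1.2| * ‖Jf U (z.1.2 - z.1.2 * z.2.1) z.1.1 z.2.2‖)
      ≤ ‖ψ z.1.2‖ * (|z.1.2| * (C * (1 + |z.1.2|) ^ 2 * (1 + z.1.1 ^ 2)⁻¹ * (1 + z.2.2 ^ 2)⁻¹)) := by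
        gcongr
        refine h1.trans ?_
        gcongr
    _ = _ := by ring

lemma duhamel_eq (u U : SchwartzMap (ℝ × ℝ) ℂ) (hU : ∀ q, U q = F2 u q) (t x : ℝ) :
    ∫ s in (0 : ℝ)..t, W (fun y => u (y, s)) (t - s) x =
    ((((2 * Real.pi : ℝ)⁻¹ : ℝ) : ℂ)) ^ 2 * ∫ θ in Set.Ioc (0 : ℝ) 1, ∫ τ, (t : ℂ) *
      (Complex.exp (Complex.I * ((t * θ * τ : ℝ) : ℂ)) * Jf U (t - t * θ) x τ) := by
  have h := intervalIntegral.smul_integral_comp_mul_left (a := 0) (b := 1)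
    (fun s => W (fun y => u (y, s)) (t - s) x) t
  rw [mul_zero, mul_one] at h
  rw [← h, intervalIntegral.integral_of_le zero_le_one, Complex.real_smul]
  simp_rw [W_eq u U hU, integral_const_mul]
  ring

lemma lhs_eq (ψ : SchwartzMap ℝ ℂ) (u U : SchwartzMap (ℝ × ℝ) ℂ) (hU : ∀ q, U q = F2 u q)
    (ξ τ₀ : ℝ) :
    F2 (fun p : ℝ × ℝ =>
          ψ p.2 * ∫ s in (0 : ℝ)..p.2, W (fun y => u (y, s)) (p.2 - s) p.1) (ξ, τ₀) =
    ((((2 * Real.pi : ℝ)⁻¹ : ℝ) : ℂ)) ^ 2 *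
      ∫ p, ∫ q, Phi ψ U ξ τ₀ (p, q) ∂nuq ∂((volume : Measure ℝ).prod volume) := by
  have hI := Phi_integrable ψ U ξ τ₀
  rw [F2, Measure.volume_eq_prod, ← integral_const_mul]
  refine integral_congr_ae ?_
  filter_upwards [hI.prod_right_ae] with p hp
  rw [duhamel_eq u U hU]
  have : ∫ q, Phi ψ U ξ τ₀ (p, q) ∂nuq = ∫ θ in Set.Ioc (0 : ℝ) 1, ∫ τ, Phi ψ U ξ τ₀ (p, (θ, τ)) :=
    integral_prod _ hp
  rw [this]
  simp only [Phi, integral_const_mul]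
  ring

lemma x_integral (ψ : SchwartzMap ℝ ℂ) (U : SchwartzMap (ℝ × ℝ) ℂ) (ξ τ₀ : ℝ) (q : ℝ × ℝ)
    (hq : Integrable (fun p => Phi ψ U ξ τ₀ (p, q)) ((volume : Measure ℝ).prod volume)) :
    ∫ p, Phi ψ U ξ τ₀ (p, q) ∂((volume : Measure ℝ).prod volume) =
    ∫ t, (2 * Real.pi * U (ξ, q.2)) * (Complex.exp (-Complex.I * ((t * τ₀ : ℝ) : ℂ)) * ψ t * ((t : ℂ) *
      (Complex.exp (Complex.I * ((t * q.1 * q.2 : ℝ) : ℂ)) *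
       Complex.exp (Complex.I * (((t - t * q.1) * ω ξ : ℝ) : ℂ))))) := by
  rw [integral_prod_symm _ hq]
  congr 1; ext t
  have : ∀ x, Phi ψ U ξ τ₀ ((x, t), q) = (Complex.exp (-Complex.I * ((t * τ₀ : ℝ) : ℂ)) * ψ t * ((t : ℂ) *
      Complex.exp (Complex.I * ((t * q.1 * q.2 : ℝ) : ℂ)))) *
      (Complex.exp (-Complex.I * ((x * ξ : ℝ) : ℂ)) * Jf U (t - t * q.1) x q.2) := by
    intro x
    have e : -Complex.I * ((x * ξ + t * τ₀ : ℝ) : ℂ) = -Complex.I * ((t * τ₀ : ℝ) : ℂ) +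
      -Complex.I * ((x * ξ : ℝ) : ℂ) := by push_cast; ring
    simp only [Phi]
    rw [e, Complex.exp_add]
    ring
  simp_rw [this]
  rw [integral_const_mul, Jf_fourier]
  ring

lemma t_integral (ψ : SchwartzMap ℝ ℂ) (τ₀ τ w : ℝ) (h : τ ≠ w) :
    ∫ θ in Set.Ioc (0 : ℝ) 1, ∫ t, (Complex.exp (-Complex.I * ((t * τ₀ : ℝ) : ℂ)) * ψ t * ((t : ℂ) *
      (Complex.exp (Complex.I * ((t * θ * τ : ℝ) : ℂ)) *
       Complex.exp (Complex.I * (((t - t * θ) * w : ℝ) : ℂ))))) =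
    (F1 ψ (τ₀ - τ) - F1 ψ (τ₀ - w)) / (Complex.I * ((τ - w : ℝ) : ℂ)) := by
  have hψ := ψ.continuous
  rw [integral_integral_swap]
  · have key : ∀ t : ℝ, ∫ θ in Set.Ioc (0 : ℝ) 1, (Complex.exp (-Complex.I * ((t * τ₀ : ℝ) : ℂ)) * ψ t * ((t : ℂ) *
      (Complex.exp (Complex.I * ((t * θ * τ : ℝ) : ℂ)) *
       Complex.exp (Complex.I * (((t - t * θ) * w : ℝ) : ℂ))))) =
       (Complex.exp (-Complex.I * ((t * (τ₀ - τ) : ℝ) : ℂ)) * ψ t -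
        Complex.exp (-Complex.I * ((t * (τ₀ - w) : ℝ) : ℂ)) * ψ t) / (Complex.I * ((τ - w : ℝ) : ℂ)) := by
      intro t
      rw [integral_const_mul, theta_integral t τ w h, mul_div_assoc']
      congr 1
      have e : ∀ a : ℝ, Complex.exp (-Complex.I * ((t * (τ₀ - a) : ℝ) : ℂ)) =
        Complex.exp (-Complex.I * ((t * τ₀ : ℝ) : ℂ)) * Complex.exp (Complex.I * ((t * a : ℝ) : ℂ)) := by
        intro a; rw [← Complex.exp_add]; congr 1; push_cast; ring
      rw [e, e]; ring
    simp_rw [key]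
    have hi : ∀ a : ℝ, Integrable (fun t : ℝ => Complex.exp (-Complex.I * ((t * a : ℝ) : ℂ)) * ψ t) := by
      intro a
      simp_rw [neg_cis]
      exact integrable_cis_mul ψ.integrable (by fun_prop)
    rw [integral_div, integral_sub (hi _) (hi _)]
    rfl
  · have i2 : Integrable (fun z : ℝ × ℝ => (1 : ℝ) * (‖z.2‖ ^ 1 * ‖ψ z.2‖))
        ((volume.restrict (Set.Ioc (0 : ℝ) 1)).prod volume) :=
      Integrable.mul_prod (f := fun _ => (1 : ℝ)) (integrable_const 1) (ψ.integrable_pow_mul volume 1)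
    refine i2.mono' (Continuous.aestronglyMeasurable ?_) (Filter.Eventually.of_forall fun z => ?_)
    · simp only [Function.uncurry_def]
      fun_prop
    · simp only [Function.uncurry_def, neg_cis, norm_mul, norm_cis, Complex.norm_real]
      apply le_of_eq; ring

theorem fourier_of_duhamel_term :
    ∃ c : ℂ, ∀ (ψ : SchwartzMap ℝ ℂ) (u : SchwartzMap (ℝ × ℝ) ℂ) (ξ τ : ℝ),
      F2 (fun p : ℝ × ℝ =>
          ψ p.2 * ∫ s in (0 : ℝ)..p.2, W (fun y => u (y, s)) (p.2 - s) p.1) (ξ, τ) =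
        c * ∫ τ' : ℝ, F2 (⇑u) (ξ, τ') *
          (F1 (⇑ψ) (τ - τ') - F1 (⇑ψ) (τ - ω ξ)) / ((τ' - ω ξ : ℝ) : ℂ) := by
  refine ⟨(2 * Real.pi * Complex.I)⁻¹, fun ψ u ξ τ₀ => ?_⟩
  obtain ⟨U, hU⟩ := F2_schwartz u
  have hp : (Real.pi : ℂ) ≠ 0 := by exact_mod_cast Real.pi_ne_zero
  have hI := Phi_integrable ψ U ξ τ₀
  rw [lhs_eq ψ u U hU, integral_integral_swap (f := fun p q => Phi ψ U ξ τ₀ (p, q)) hI]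
  have h2 : ∫ q, ∫ p, Phi ψ U ξ τ₀ (p, q) ∂((volume : Measure ℝ).prod volume) ∂nuq =
      ∫ q : ℝ × ℝ, (∫ t : ℝ, (2 * Real.pi * U (ξ, q.2)) * (Complex.exp (-Complex.I * ((t * τ₀ : ℝ) : ℂ)) * ψ t * ((t : ℂ) *
      (Complex.exp (Complex.I * ((t * q.1 * q.2 : ℝ) : ℂ)) *
       Complex.exp (Complex.I * (((t - t * q.1) * ω ξ : ℝ) : ℂ)))))) ∂nuq := by
    refine integral_congr_ae ?_
    filter_upwards [hI.prod_left_ae] with q hq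
    exact x_integral ψ U ξ τ₀ q hq
  have hi2 : Integrable (fun q : ℝ × ℝ => ∫ t, (2 * Real.pi * U (ξ, q.2)) * (Complex.exp (-Complex.I * ((t * τ₀ : ℝ) : ℂ)) * ψ t * ((t : ℂ) *
      (Complex.exp (Complex.I * ((t * q.1 * q.2 : ℝ) : ℂ)) *
       Complex.exp (Complex.I * (((t - t * q.1) * ω ξ : ℝ) : ℂ)))))) nuq := by
    refine hI.integral_prod_right.congr ?_
    filter_upwards [hI.prod_left_ae] with q hq
    exact x_integral ψ U ξ τ₀ q hq
  rw [h2]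
  have h3 := integral_prod_symm _ hi2
  unfold nuq
  rw [h3, ← integral_const_mul, ← integral_const_mul]
  refine integral_congr_ae ?_
  have hne : ∀ᵐ τ : ℝ, τ ≠ ω ξ := by simp [ae_iff]
  filter_upwards [hne] with τ hτ
  simp only [integral_const_mul]
  rw [t_integral ψ τ₀ τ (ω ξ) hτ, hU]
  have hs : ((τ - ω ξ : ℝ) : ℂ) ≠ 0 := by exact_mod_cast sub_ne_zero.2 hτ
  have hI0 := Complex.I_ne_zero
  rw [Complex.ofReal_inv, Complex.ofReal_mul, Complex.ofReal_ofNat]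
  field_simp
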